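/- Let A_{ij;k}(x_{ij},x_{ik},x_{jk}) = α_{ij;k} x_{ik} x_{jk} + β^{(i)}_{ij;k} x_{ij} x_{ik} + β^{(j)}_{ij;k} x_{ij} x_{jk} + λ_{ij;k} x_{ij}² + μ^{(i)}_{ij;k} x_{ik}² + μ^{(j)}_{ij;k} x_{jk}² be a family of quadratic polynomials indexed by labels (ij;k) with i,j,k ∈ {1,2,3,4}, and suppose α_{ij;k} = 0 and λ_{ij;k} ≠ 0 for all labels. Then the family satisfies the system (A2) if and only if β^{(i)}_{ij;k} = β^{(j)}_{ij;k} = 0 and μ^{(i)}_{ij;k} = μ^{(j)}_{ij;k} = 0 for all labels, i.e. if and only if A_{ij;k} = λ_{ij;k} x_{ij}²; in that case (A2) holds with no further conditions on the constants λ_{ij;k}. -/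

import Mathlib

/- Statement 5 (case (II)): for quadratic families with `α_{ij;k} = 0` and `λ_{ij;k} ≠ 0`,
   the system (A2) holds iff all `β` and `μ` coefficients vanish, i.e. iff
   `A_{ij;k} = λ_{ij;k} x_{ij}²`; no further conditions on the `λ`'s arise. -/

noncomputable section

open MvPolynomial

/-- The variable index of `x_{ij} = x_{ji}`: the sorted pair. -/
def vd (i j : Fin 4) : Fin 4 × Fin 4 := if i ≤ j then (i, j) else (j, i)

/-- The variable `x_{ij}` in the polynomial ring in the six variables `x_{pq}`. -/
def xv (i j : Fin 4) : MvPolynomial (Fin 4 × Fin 4) ℝ := X (vd i j)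

/-- The quadratic polynomial `A_{ij;k}`, written out in the six variables `x_{pq}`.
    Here `β i j k` denotes `β^{(i)}_{ij;k}` and `μ i j k` denotes `μ^{(i)}_{ij;k}`;
    the symmetry convention `A_{ij;k} = A_{ji;k}` then swaps the superscripts. -/
def quadA (α β lam μ : Fin 4 → Fin 4 → Fin 4 → ℝ) (i j k : Fin 4) :
    MvPolynomial (Fin 4 × Fin 4) ℝ :=
  C (α i j k) * xv i k * xv j k + C (β i j k) * xv i j * xv i k +
    C (β j i k) * xv i j * xv j k + C (lam i j k) * xv i j ^ 2 +
    C (μ i j k) * xv i k ^ 2 + C (μ j i k) * xv j k ^ 2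

/-- The system (A2), as an identity in the six variables `x_{pq}`,
    for every `{i,j,k,ℓ} = {1,2,3,4}`. -/
def SystemA2 (A : Fin 4 → Fin 4 → Fin 4 → MvPolynomial (Fin 4 × Fin 4) ℝ) : Prop :=
  ∀ i j k l : Fin 4, ({i, j, k, l} : Finset (Fin 4)) = Finset.univ →
    pderiv (vd i j) (A i j k) * A i j l + pderiv (vd i k) (A i j k) * A i k l +
        pderiv (vd j k) (A i j k) * A j k l =
      pderiv (vd i j) (A i j l) * A i j k + pderiv (vd i l) (A i j l) * A i l k +
        pderiv (vd j l) (A i j l) * A j l k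

theorem vd_eq_vd_iff (p q r s : Fin 4) :
    vd p q = vd r s ↔ (p = r ∧ q = s) ∨ (p = s ∧ q = r) := by
  revert p q r s
  decide

/-- With `α_{ij;k} = 0`, the partial derivatives of `A_{ij;k}`. -/
theorem pderiv_quadA {α β lam μ : Fin 4 → Fin 4 → Fin 4 → ℝ} {i j k : Fin 4}
    (hij : i ≠ j) (hik : i ≠ k) (hjk : j ≠ k) (hα : α i j k = 0) :
    pderiv (vd i j) (quadA α β lam μ i j k) =
        C (β i j k) * xv i k + C (β j i k) * xv j k + 2 * C (lam i j k) * xv i j ∧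
      pderiv (vd i k) (quadA α β lam μ i j k) =
        C (β i j k) * xv i j + 2 * C (μ i j k) * xv i k ∧
      pderiv (vd j k) (quadA α β lam μ i j k) =
        C (β j i k) * xv i j + 2 * C (μ j i k) * xv j k := by
  refine ⟨?_, ?_, ?_⟩ <;>
  · simp [quadA, xv, hα, pderiv_X, vd_eq_vd_iff, hij, hik, hjk,
      hij.symm, hik.symm, hjk.symm, Derivation.leibniz_pow]
    ring

theorem pairwise_ne_of_eq_univ {i j k l : Fin 4}
    (h : ({i, j, k, l} : Finset (Fin 4)) = Finset.univ) :
    i ≠ j ∧ i ≠ k ∧ i ≠ l ∧ j ≠ k ∧ j ≠ l ∧ k ≠ l := by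
  revert i j k l
  decide

theorem exists_fourth_index {i j k : Fin 4} (hij : i ≠ j) (hik : i ≠ k) (hjk : j ≠ k) :
    ∃ l, i ≠ l ∧ j ≠ l ∧ k ≠ l ∧ ({i, j, k, l} : Finset (Fin 4)) = Finset.univ := by
  have hu : ∃ l, ({i, j, k, l} : Finset (Fin 4)) = Finset.univ := by
    revert i j k
    decide
  obtain ⟨l, hl⟩ := hu
  obtain ⟨-, -, hil, -, hjl, hkl⟩ := pairwise_ne_of_eq_univ hl
  exact ⟨l, hil, hjl, hkl, hl⟩

/-- Comparing coefficients of `x_{ik}³`. -/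
theorem SystemA2.mu_eq_zero {α β lam μ : Fin 4 → Fin 4 → Fin 4 → ℝ}
    (hα0 : ∀ i j k : Fin 4, i ≠ j → i ≠ k → j ≠ k → α i j k = 0)
    (hlam : ∀ i j k : Fin 4, i ≠ j → i ≠ k → j ≠ k → lam i j k ≠ 0)
    (h : SystemA2 (quadA α β lam μ)) {i j k : Fin 4}
    (hij : i ≠ j) (hik : i ≠ k) (hjk : j ≠ k) :
    μ i j k = 0 := by
  obtain ⟨l, hil, hjl, hkl, hu⟩ := exists_fourth_index hij hik hjk
  have key := h i j k l hu
  obtain ⟨d₁, d₂, d₃⟩ := pderiv_quadA (β := β) (lam := lam) (μ := μ) hij hik hjk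
    (hα0 i j k hij hik hjk)
  obtain ⟨e₁, e₂, e₃⟩ := pderiv_quadA (β := β) (lam := lam) (μ := μ) hij hil hjl
    (hα0 i j l hij hil hjl)
  rw [d₁, d₂, d₃, e₁, e₂, e₃] at key
  have key' := congrArg (eval (Pi.single (vd i k) (1 : ℝ))) key
  simpa [quadA, xv, Pi.single_apply, vd_eq_vd_iff, hij, hik, hjk, hil, hjl, hkl, hij.symm,
    hik.symm, hjk.symm, hil.symm, hjl.symm, hkl.symm, hlam i k l hik hil hkl] using key'

/-- Comparing coefficients of `x_{ij}² x_{ik}`, once all `μ` vanish. -/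
theorem SystemA2.beta_eq_zero {α β lam μ : Fin 4 → Fin 4 → Fin 4 → ℝ}
    (hα0 : ∀ i j k : Fin 4, i ≠ j → i ≠ k → j ≠ k → α i j k = 0)
    (hlam : ∀ i j k : Fin 4, i ≠ j → i ≠ k → j ≠ k → lam i j k ≠ 0)
    (h : SystemA2 (quadA α β lam μ)) {i j k : Fin 4}
    (hij : i ≠ j) (hik : i ≠ k) (hjk : j ≠ k) :
    β i j k = 0 := by
  have hμ : ∀ {p q r : Fin 4}, p ≠ q → p ≠ r → q ≠ r → μ p q r = 0 :=
    fun h₁ h₂ h₃ => SystemA2.mu_eq_zero hα0 hlam h h₁ h₂ h₃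
  obtain ⟨l, hil, hjl, hkl, hu⟩ := exists_fourth_index hij hik hjk
  have key := h i j k l hu
  obtain ⟨d₁, d₂, d₃⟩ := pderiv_quadA (β := β) (lam := lam) (μ := μ) hij hik hjk
    (hα0 i j k hij hik hjk)
  obtain ⟨e₁, e₂, e₃⟩ := pderiv_quadA (β := β) (lam := lam) (μ := μ) hij hil hjl
    (hα0 i j l hij hil hjl)
  rw [d₁, d₂, d₃, e₁, e₂, e₃] at key
  have key' (t : ℝ) : (β i j k * t + 2 * lam i j k) * lam i j l + β i j k * (lam i k l * t ^ 2) =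
      2 * lam i j l * (β i j k * t + lam i j k) := by
    have := congrArg (eval (Pi.single (vd i j) (1 : ℝ) + Pi.single (vd i k) t)) key
    simpa [quadA, xv, Pi.single_apply, vd_eq_vd_iff, hij, hik, hjk, hil, hjl, hkl, hij.symm,
      hik.symm, hjk.symm, hil.symm, hjl.symm, hkl.symm, hμ] using this
  have hprod : β i j k * lam i j l = 0 := by linarith [key' 1, key' (-1)]
  exact (mul_eq_zero.mp hprod).resolve_right (hlam i j l hij hil hjl)

theorem stmt_5 (α β lam μ : Fin 4 → Fin 4 → Fin 4 → ℝ)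
    (hlamsym : ∀ i j k, lam i j k = lam j i k)
    (hα0 : ∀ i j k : Fin 4, i ≠ j → i ≠ k → j ≠ k → α i j k = 0)
    (hlam : ∀ i j k : Fin 4, i ≠ j → i ≠ k → j ≠ k → lam i j k ≠ 0) :
    SystemA2 (quadA α β lam μ) ↔
      (∀ i j k : Fin 4, i ≠ j → i ≠ k → j ≠ k →
        β i j k = 0 ∧ β j i k = 0 ∧ μ i j k = 0 ∧ μ j i k = 0) := by
  constructor
  · intro h i j k hij hik hjk
    exact ⟨h.beta_eq_zero hα0 hlam hij hik hjk, h.beta_eq_zero hα0 hlam hij.symm hjk hik,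
      h.mu_eq_zero hα0 hlam hij hik hjk, h.mu_eq_zero hα0 hlam hij.symm hjk hik⟩
  · intro h i j k l hu
    obtain ⟨hij, hik, hil, hjk, hjl, hkl⟩ := pairwise_ne_of_eq_univ hu
    obtain ⟨d₁, d₂, d₃⟩ := pderiv_quadA (β := β) (lam := lam) (μ := μ) hij hik hjk
      (hα0 i j k hij hik hjk)
    obtain ⟨e₁, e₂, e₃⟩ := pderiv_quadA (β := β) (lam := lam) (μ := μ) hij hil hjl
      (hα0 i j l hij hil hjl)
    obtain ⟨b₁, b₂, m₁, m₂⟩ := h i j k hij hik hjk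
    obtain ⟨b₃, b₄, m₃, m₄⟩ := h i j l hij hil hjl
    rw [d₁, d₂, d₃, e₁, e₂, e₃]
    simp only [quadA, hα0 i j k hij hik hjk, hα0 i j l hij hil hjl, b₁, b₂, b₃, b₄, m₁, m₂, m₃,
      m₄, C_0]
    ring

end
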